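/- arXiv:1902.10912 — 9 statements merged into one kernel-verified Lean document; each statement's English description precedes it below -/
import Mathlib

section
/- Let ℓ be a positive integer (finite number of colors) and let μ be an infinite cardinal. Then μ →_hc (μ)²_ℓ holds: for every coloring c of the unordered pairs of ordinals below μ by ℓ colors, there exist a color i < ℓ, a set V ⊆ μ of cardinality μ, and a set E of pairs from V each of which is assigned the color i by c, such that the graph (V, E) is highly connected. -/
open Cardinal Ordinal Set

noncomputable section

/-- The color assigned by the coloring `c` to the unordered pair `{a, b}`. -/
def EdgeColor (c : Ordinal.{0} → Ordinal.{0} → Ordinal.{0}) (a b : Ordinal) : Ordinal :=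
  c (min a b) (max a b)

/-- `c` is a coloring of the unordered pairs of ordinals below `ν` by `lam` colors:
its value on each pair `a < b < ν` is an ordinal (color) below `lam`. -/
def IsColoring (ν lam : Cardinal.{0}) (c : Ordinal.{0} → Ordinal.{0} → Ordinal.{0}) : Prop :=
  ∀ a b : Ordinal, a < b → b < ν.ord → c a b < lam.ord

/-- `X ⊆ ν` is well-connected in the color `i` (with respect to the coloring `c` of the
pairs of ordinals below `ν`): for all `α < β` in `X` there is a finite path from `α` to `β`
through ordinals below `ν`, all of whose edges are colored `i` and all of whose vertices
are `≥ α` (the vertices need not lie in `X`). -/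
def WellConnectedIn (ν : Cardinal.{0}) (c : Ordinal.{0} → Ordinal.{0} → Ordinal.{0})
    (i : Ordinal) (X : Set Ordinal.{0}) : Prop :=
  ∀ α ∈ X, ∀ β ∈ X, α < β → ∃ n : ℕ, ∃ v : Fin (n + 1) → Ordinal,
    v 0 = α ∧ v (Fin.last n) = β ∧ (∀ j, v j < ν.ord ∧ α ≤ v j) ∧
    ∀ j : Fin n, v j.castSucc ≠ v j.succ ∧ EdgeColor c (v j.castSucc) (v j.succ) = i

/-- Adjacency in the graph with edge set `E` (edges recorded as ordered pairs). -/
def GraphAdj (E : Set (Ordinal.{0} × Ordinal.{0})) (a b : Ordinal) : Prop :=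
  (a, b) ∈ E ∨ (b, a) ∈ E

/-- The graph with edge set `E` is connected on the vertex set `W`: any two distinct
vertices of `W` are joined by a finite path all of whose vertices lie in `W`. -/
def ConnectedOn (E : Set (Ordinal.{0} × Ordinal.{0})) (W : Set Ordinal.{0}) : Prop :=
  ∀ a ∈ W, ∀ b ∈ W, a ≠ b → ∃ n : ℕ, ∃ v : Fin (n + 1) → Ordinal,
    v 0 = a ∧ v (Fin.last n) = b ∧ (∀ j, v j ∈ W) ∧
    ∀ j : Fin n, GraphAdj E (v j.castSucc) (v j.succ)

/-- The graph `(V, E)` is highly connected: it remains connected after the deletion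
of any set of fewer than `|V|` of its vertices. -/
def HighlyConnected (V : Set Ordinal.{0}) (E : Set (Ordinal.{0} × Ordinal.{0})) : Prop :=
  ∀ S : Set Ordinal.{0}, S ⊆ V → #S < #V → ConnectedOn E (V \ S)

/-- The partition relation `ν →_hc (μ)²_lam`: for every coloring of the pairs of ordinals
below `ν` by `lam` colors there are a color `i < lam`, a set `V ⊆ ν` of cardinality `μ`
and a set `E` of pairs from `V` each colored `i`, with `(V, E)` highly connected. -/
def ArrowHC (ν μ lam : Cardinal.{0}) : Prop :=
  ∀ c : Ordinal.{0} → Ordinal.{0} → Ordinal.{0}, IsColoring ν lam c →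
    ∃ i < lam.ord, ∃ V : Set Ordinal.{0}, ∃ E : Set (Ordinal.{0} × Ordinal.{0}),
      V ⊆ Set.Iio ν.ord ∧ #V = Cardinal.lift.{1} μ ∧
      (∀ p ∈ E, p.1 ∈ V ∧ p.2 ∈ V ∧ p.1 < p.2 ∧ c p.1 p.2 = i) ∧
      HighlyConnected V E


/-- The filter of the sets of ordinals that contain all but fewer than `μ` ordinals below `μ.ord`. -/
def coSmallBelow (μ : Cardinal.{0}) (hμ : ℵ₀ ≤ μ) : Filter Ordinal.{0} :=
  Filter.comk (fun t => #(t ∩ Set.Iio μ.ord : Set Ordinal.{0}) < Cardinal.lift.{1} μ)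
    (by simpa using lt_of_lt_of_le aleph0_pos hμ)
    (fun _ ht _ hst => (mk_le_mk_of_subset (inter_subset_inter_left _ hst)).trans_lt ht)
    (fun s hs t ht => by
      rw [union_inter_distrib_right]
      exact (mk_union_le _ _).trans_lt (add_lt_of_lt (by simpa using hμ) hs ht))

theorem mk_Iio_ord_eq_lift (μ : Cardinal.{0}) :
    #(Set.Iio μ.ord) = Cardinal.lift.{1} μ := by
  simp

instance coSmallBelow_neBot (μ : Cardinal.{0}) (hμ : ℵ₀ ≤ μ) : (coSmallBelow μ hμ).NeBot := by
  rw [Filter.neBot_iff, Ne, ← Filter.empty_mem_iff_bot, coSmallBelow, Filter.mem_comk]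
  simp

/-- Every infinite cardinal `μ` carries a uniform ultrafilter. -/
theorem exists_uniform_ultrafilter (μ : Cardinal.{0}) (hμ : ℵ₀ ≤ μ) :
    ∃ U : Ultrafilter Ordinal.{0}, Set.Iio μ.ord ∈ U ∧
      ∀ s : Set Ordinal.{0}, #s < Cardinal.lift.{1} μ → sᶜ ∈ U := by
  refine ⟨Ultrafilter.of (coSmallBelow μ hμ), ?_, fun s hs => ?_⟩
  · apply Ultrafilter.of_le
    rw [coSmallBelow, Filter.mem_comk, compl_inter_self]
    simpa using lt_of_lt_of_le aleph0_pos hμ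
  · apply Ultrafilter.of_le
    rw [coSmallBelow, Filter.mem_comk, compl_compl]
    exact (mk_le_mk_of_subset inter_subset_left).trans_lt hs

/-- A function that takes its values in a finite set along an ultrafilter is constant along it. -/
theorem Ultrafilter.exists_eventually_eq_of_finite {α β : Type*} (U : Ultrafilter α) {t : Set β}
    (ht : t.Finite) {f : α → β} (hf : ∀ᶠ x in U, f x ∈ t) :
    ∃ i ∈ t, ∀ᶠ x in U, f x = i := by
  have h : (⋃ i ∈ t, {x | f x = i}) ∈ U := by
    filter_upwards [hf] with x hx
    simpa using hx
  exact (Ultrafilter.finite_biUnion_mem_iff ht).1 h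

theorem finite_Iio_ord_natCast (n : ℕ) : (Set.Iio (n : Cardinal.{0}).ord).Finite := by
  rw [← lt_aleph0_iff_set_finite, mk_Iio_ord_eq_lift]
  simp

theorem edgeColor_lt {ν lam : Cardinal.{0}} {c : Ordinal.{0} → Ordinal.{0} → Ordinal.{0}}
    (hc : IsColoring ν lam c) {a b : Ordinal} (ha : a < ν.ord) (hb : b < ν.ord) (hab : a ≠ b) :
    EdgeColor c a b < lam.ord :=
  hc _ _ (min_lt_max.2 hab) (max_lt ha hb)

/-- Distinct vertices in `V` whose pair has color `i` are adjacent in the graph of all pairs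
from `V` of color `i`. -/
theorem graphAdj_of_edgeColor_eq {c : Ordinal.{0} → Ordinal.{0} → Ordinal.{0}} {i : Ordinal}
    {V : Set Ordinal.{0}} {a b : Ordinal} (ha : a ∈ V) (hb : b ∈ V) (hab : a ≠ b)
    (h : EdgeColor c a b = i) :
    GraphAdj {p | p.1 ∈ V ∧ p.2 ∈ V ∧ p.1 < p.2 ∧ c p.1 p.2 = i} a b := by
  rcases hab.lt_or_gt with hlt | hlt
  · exact Or.inl ⟨ha, hb, hlt, by simpa [EdgeColor, hlt.le] using h⟩
  · exact Or.inr ⟨hb, ha, hlt, by simpa [EdgeColor, hlt.le] using h⟩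

theorem GraphAdj.symm {E : Set (Ordinal.{0} × Ordinal.{0})} {a b : Ordinal}
    (h : GraphAdj E a b) : GraphAdj E b a :=
  Or.symm h

/-- Proposition 2 (`finite`): for every positive integer `ℓ` and every infinite cardinal
`μ`, the relation `μ →_hc (μ)²_ℓ` holds. -/
theorem hc_arrow_of_finitely_many_colors (ℓ : ℕ) (hℓ : 0 < ℓ) (μ : Cardinal.{0})
    (hμ : ℵ₀ ≤ μ) : ArrowHC μ μ (ℓ : Cardinal.{0}) := by
  intro c hc
  obtain ⟨U, hU, hsmall⟩ := exists_uniform_ultrafilter μ hμ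
  have hne : ∀ a : Ordinal.{0}, ∀ᶠ b in U, a ≠ b := fun a => by
    have h := hsmall {a} (by simpa using one_lt_aleph0.trans_le hμ)
    filter_upwards [h] with b hb using Ne.symm hb
  have hcol : ∀ a : Ordinal.{0}, ∃ i, a < μ.ord →
      i < (ℓ : Cardinal.{0}).ord ∧ ∀ᶠ b in U, EdgeColor c a b = i := fun a => by
    by_cases ha : a < μ.ord
    · obtain ⟨i, hi, h⟩ := U.exists_eventually_eq_of_finite (finite_Iio_ord_natCast ℓ)
        (f := EdgeColor c a) (by
          filter_upwards [hU, hne a] with b hb hab using edgeColor_lt hc ha hb hab)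
      exact ⟨i, fun _ => ⟨hi, h⟩⟩
    · exact ⟨0, fun h => absurd h ha⟩
  choose f hf using hcol
  obtain ⟨i, hi, hfi⟩ := U.exists_eventually_eq_of_finite (finite_Iio_ord_natCast ℓ) (f := f)
    (by filter_upwards [hU] with a ha using (hf a ha).1)
  set V : Set Ordinal.{0} := {a | a < μ.ord ∧ f a = i}
  have hV : V ∈ U := by filter_upwards [hU, hfi] with a ha h using ⟨ha, h⟩
  have hVμ : V ⊆ Set.Iio μ.ord := fun a ha => ha.1
  have hcard : #V = Cardinal.lift.{1} μ := by
    refine le_antisymm ((mk_le_mk_of_subset hVμ).trans_eq (mk_Iio_ord_eq_lift μ)) ?_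
    by_contra! h
    exact Ultrafilter.compl_mem_iff_notMem.1 (hsmall V h) hV
  refine ⟨i, hi, V, {p | p.1 ∈ V ∧ p.2 ∈ V ∧ p.1 < p.2 ∧ c p.1 p.2 = i}, hVμ, hcard,
    fun p hp => hp, fun S _ hSV a ha b hb _ => ?_⟩
  have hadj : ∀ a ∈ V, ∀ᶠ x in U, a ≠ x ∧ EdgeColor c a x = i := fun a ha => by
    filter_upwards [hne a, (hf a ha.1).2] with x hx h using ⟨hx, h.trans ha.2⟩
  obtain ⟨x, hxV, hxS, hax, hbx⟩ := (Filter.Eventually.and hV <|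
    (Filter.Eventually.and (hsmall S (hcard ▸ hSV))) <|
    (hadj a ha.1).and (hadj b hb.1)).exists
  refine ⟨2, ![a, x, b], rfl, rfl, ?_, ?_⟩
  · intro j
    fin_cases j
    exacts [ha, ⟨hxV, hxS⟩, hb]
  · intro j
    fin_cases j
    exacts [graphAdj_of_edgeColor_eq ha.1 hxV hax.1 hax.2,
      (graphAdj_of_edgeColor_eq hb.1 hxV hbx.1 hbx.2).symm]

end
end

section
/- For all cardinals ν, μ, λ: if ν →_hc (μ)²_λ holds, then ν →_wc (μ)²_λ holds. -/
open Cardinal Ordinal Set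

noncomputable section

/-- The partition relation `ν →_wc (μ)²_lam`: for every coloring of the pairs of ordinals
below `ν` by `lam` colors there are a color `i < lam` and a set `X ⊆ ν` of cardinality `μ`
which is well-connected in the color `i`. -/
def ArrowWC (ν μ lam : Cardinal.{0}) : Prop :=
  ∀ c : Ordinal.{0} → Ordinal.{0} → Ordinal.{0}, IsColoring ν lam c →
    ∃ i < lam.ord, ∃ X : Set Ordinal.{0}, X ⊆ Set.Iio ν.ord ∧ #X = Cardinal.lift.{1} μ ∧
      WellConnectedIn ν c i X


/-- In a well-ordered type, the elements of `V` with fewer than `|V|` predecessors in `V` form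
a set of cardinality `|V|`. -/
theorem mk_setOf_mk_inter_Iio_lt {α : Type*} [LinearOrder α] [WellFoundedLT α] (V : Set α) :
    #{x | x ∈ V ∧ #(V ∩ Iio x : Set α) < #V} = #V := by
  refine le_antisymm (mk_le_mk_of_subset fun x hx => hx.1) ?_
  by_cases hV : ∀ x ∈ V, #(V ∩ Iio x : Set α) < #V
  · exact mk_le_mk_of_subset fun x hx => ⟨hx, hV x hx⟩
  · push Not at hV
    obtain ⟨y, ⟨-, hy⟩, hmin⟩ :=
      wellFounded_lt.has_min {x | x ∈ V ∧ #V ≤ #(V ∩ Iio x : Set α)} hV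
    exact hy.trans (mk_le_mk_of_subset fun x hx =>
      ⟨hx.1, lt_of_not_ge fun hle => hmin x ⟨hx.1, hle⟩ hx.2⟩)

/-- Lemma 6 (`positive`), second implication: `ν →_hc (μ)²_lam` implies
`ν →_wc (μ)²_lam`. -/
theorem arrowWC_of_arrowHC (ν μ lam : Cardinal.{0}) (h : ArrowHC ν μ lam) :
    ArrowWC ν μ lam := by
  intro c hc
  obtain ⟨i, hi, V, E, hVν, hVμ, hE, hV⟩ := h c hc
  refine ⟨i, hi, {x | x ∈ V ∧ #(V ∩ Iio x : Set Ordinal) < #V}, fun x hx => hVν hx.1,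
    (mk_setOf_mk_inter_Iio_lt V).trans hVμ, fun α hα β hβ hαβ => ?_⟩
  obtain ⟨n, v, hv0, hvn, hvV, hvE⟩ := hV (V ∩ Iio α) inter_subset_left hα.2
    α ⟨hα.1, fun hmem => lt_irrefl α hmem.2⟩ β ⟨hβ.1, fun hmem => hαβ.not_gt hmem.2⟩ hαβ.ne
  refine ⟨n, v, hv0, hvn, fun j => ⟨hVν (hvV j).1, ?_⟩, fun j => ?_⟩
  · exact le_of_not_gt fun hlt => (hvV j).2 ⟨(hvV j).1, hlt⟩
  · rcases hvE j with hj | hj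
    · obtain ⟨-, -, hlt, hcol⟩ := hE _ hj
      exact ⟨hlt.ne, by simpa [EdgeColor, min_eq_left hlt.le, max_eq_right hlt.le] using hcol⟩
    · obtain ⟨-, -, hlt, hcol⟩ := hE _ hj
      exact ⟨hlt.ne', by simpa [EdgeColor, min_eq_right hlt.le, max_eq_left hlt.le] using hcol⟩

end
end

section
/- Let λ, μ, ν be cardinals with λ infinite, λ < cf(μ), cf(μ) ≤ μ, and μ < ν. Then ν →_wc (μ)²_λ holds. -/
open Cardinal Ordinal Set

noncomputable section

/-- Lemma 7 (`gch`), first assertion: `ν →_wc (μ)²_lam` holds for any infinite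
`lam < cf(μ) ≤ μ < ν`. -/
theorem arrowWC_of_lt_cof (lam μ ν : Cardinal.{0}) (hlam : ℵ₀ ≤ lam)
    (h1 : lam < (μ.ord).cof) (h2 : (μ.ord).cof ≤ μ) (h3 : μ < ν) :
    ArrowWC ν μ lam := by
  intro c hc
  have hμ : ℵ₀ ≤ μ := (hlam.trans h1.le).trans h2
  have hμν : μ.ord < ν.ord := ord_lt_ord.2 h3
  let e : μ.ord.ToType ≃o Set.Iio μ.ord := Ordinal.ToType.mk.symm
  let f : μ.ord.ToType → lam.ord.ToType := fun a =>
    Ordinal.ToType.mk ⟨c (e a) μ.ord, hc _ _ (e a).2 hμν⟩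
  obtain ⟨i, hi⟩ := Cardinal.infinite_pigeonhole_card f μ (by simp) hμ (by simpa using h1)
  have hcard : #(f ⁻¹' {i}) = μ := le_antisymm (by simpa using mk_set_le (f ⁻¹' {i})) hi
  have hinj : Function.Injective fun a => (e a : Ordinal.{0}) :=
    Subtype.val_injective.comp e.injective
  refine ⟨Ordinal.ToType.mk.symm i, (Ordinal.ToType.mk.symm i).2,
    (fun a => (e a : Ordinal.{0})) '' (f ⁻¹' {i}), ?_, ?_, ?_⟩
  · rintro _ ⟨a, -, rfl⟩
    exact lt_trans (Set.mem_Iio.1 (e a).2) hμν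
  · have := mk_image_eq_lift (fun a => (e a : Ordinal.{0})) (f ⁻¹' {i}) hinj
    rwa [hcard, Cardinal.lift_uzero] at this
  · have hcol : ∀ a ∈ f ⁻¹' {i}, c (e a) μ.ord = Ordinal.ToType.mk.symm i := by
      rintro a rfl
      simp [f]
    rintro _ ⟨a, ha, rfl⟩ _ ⟨b, hb, rfl⟩ hab
    have ha' : (e a : Ordinal) < μ.ord := (e a).2
    have hb' : (e b : Ordinal) < μ.ord := (e b).2
    refine ⟨2, ![e a, μ.ord, e b], rfl, rfl, ?_, ?_⟩
    · intro j
      fin_cases j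
      · exact ⟨ha'.trans hμν, le_rfl⟩
      · exact ⟨hμν, ha'.le⟩
      · exact ⟨hb'.trans hμν, hab.le⟩
    · intro j
      fin_cases j
      · refine ⟨ha'.ne, ?_⟩
        change EdgeColor c (e a) μ.ord = _
        rw [EdgeColor, min_eq_left ha'.le, max_eq_right ha'.le, hcol a ha]
      · refine ⟨hb'.ne', ?_⟩
        change EdgeColor c μ.ord (e b) = _
        rw [EdgeColor, min_eq_right hb'.le, max_eq_left hb'.le, hcol b hb]

end
end

section
/- Let λ, μ, ν be cardinals with λ infinite, λ < cf(μ), cf(μ) ≤ μ, μ < ν, and μ^λ < ν. Then ν →_hc (μ)²_λ holds. -/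
open Cardinal Ordinal Set

noncomputable section

/-- A type carrying a family of `β`-ary operations indexed by `Op` has a nonempty subset closed
under all of them whose cardinality is at most any infinite `κ` with `#Op ≤ κ` and
`κ ^ #β ≤ κ`. -/
theorem exists_nonempty_closed_subset {α β Op : Type} [Nonempty α] {κ : Cardinal.{0}}
    (hκ : ℵ₀ ≤ κ) (hOp : #Op ≤ κ) (hβ : κ ^ #β ≤ κ) (g : Op → (β → α) → α) :
    ∃ N : Set α, N.Nonempty ∧ #N ≤ κ ∧ ∀ o s, (∀ j, s j ∈ N) → g o s ∈ N := by
  let arity : Option Op → Type := fun o => o.elim PEmpty fun _ => β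
  let eval : WType arity → α := WType.elim α fun p => match p with
    | ⟨none, _⟩ => Classical.arbitrary α
    | ⟨some o, s⟩ => g o s
  refine ⟨range eval, ⟨_, mem_range_self (WType.mk none PEmpty.elim)⟩, mk_range_le.trans ?_, ?_⟩
  · apply WType.cardinalMk_le_of_le
    have harity : ∀ o, κ ^ #(arity o) ≤ κ := fun o => match o with
      | none => by simpa [arity] using one_le_aleph0.trans hκ
      | some _ => hβ
    refine (Cardinal.sum_le_sum _ _ harity).trans ?_
    rw [Cardinal.sum_const', mk_option]
    exact (mul_le_mul_left (add_le_of_le hκ hOp (one_le_aleph0.trans hκ)) κ).trans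
      (mul_eq_self hκ).le
  · intro o s hs
    choose w hw using hs
    refine ⟨WType.mk (some o) w, ?_⟩
    change g o (fun j => eval (w j)) = _
    simp [hw]

/-- Every set is either covered by, or contains an injective copy of, any nonempty index type. -/
theorem exists_covering_or_injective {α M : Type} [Nonempty α] (R : Set α) :
    ∃ e : M → α, R ⊆ range e ∨ (Function.Injective e ∧ ∀ m, e m ∈ R) := by
  rcases le_total #M #R with h | h
  · obtain ⟨e⟩ := Cardinal.le_def _ _ |>.1 h
    exact ⟨fun m => e m, Or.inr ⟨Subtype.val_injective.comp e.injective, fun m => (e m).2⟩⟩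
  · obtain ⟨e⟩ := Cardinal.le_def _ _ |>.1 h
    refine ⟨Function.extend e Subtype.val fun _ => Classical.arbitrary α, Or.inl fun x hx => ?_⟩
    exact ⟨e ⟨x, hx⟩, e.injective.extend_apply _ _ _⟩

/-- Fewer than `cof μ` many sets of size less than `μ` have union of size less than `μ`. -/
theorem mk_iUnion_lt_of_lt_cof {α I : Type} {μ : Cardinal.{0}} (hμ : ℵ₀ ≤ μ)
    (hI : #I < μ.ord.cof) {B : I → Set α} (hB : ∀ i, #(B i) < μ) : #(⋃ i, B i) < μ :=
  (mk_iUnion_le B).trans_lt <|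
    mul_lt_of_lt hμ (hI.trans_le (cof_ord_le μ)) (iSup_lt_of_lt_cof_ord hI hB)

/-- The vertices joined to every entry `s j` of a family by an edge colored `f j`. -/
def realizers {α I β : Type} (d : α → α → I) (s : β → α) (f : β → I) : Set α :=
  {z | ∀ j, z ≠ s j ∧ d (s j) z = f j}

/-- There is a point `p` outside a nonempty set `N` all of whose types over families in `N` are
realized at least `μ` times in `N`. -/
theorem exists_saturated_subset {α I : Type} {μ : Cardinal.{0}} (hI : ℵ₀ ≤ #I) (hIμ : #I ≤ μ)
    (hα : μ ^ #I < #α) (d : α → α → I) :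
    ∃ N : Set α, N.Nonempty ∧ ∃ p ∉ N, ∀ s : I → α, (∀ j, s j ∈ N) →
      μ ≤ #(N ∩ realizers d s fun j => d (s j) p : Set α) := by
  have : Nonempty α := mk_ne_zero_iff.1 (ne_bot_of_gt hα)
  induction μ using Cardinal.inductionOn with | _ M
  choose e he using fun R : Set α => exists_covering_or_injective (M := M) R
  have hκ : ℵ₀ ≤ #M ^ #I := (hI.trans hIμ).trans
    (self_le_power _ (one_le_aleph0.trans hI))
  have hκI : (#M ^ #I) ^ #I = #M ^ #I := by rw [← power_mul, mul_eq_self hI]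
  have hOp : #((I → I) × M) ≤ #M ^ #I := by
    rw [mk_prod, Cardinal.lift_id, Cardinal.lift_id, ← power_def]
    exact (mul_le_mul' (power_le_power_right hIμ)
      (self_le_power _ (one_le_aleph0.trans hI))).trans (mul_eq_self hκ).le
  obtain ⟨N, hN0, hNκ, hN⟩ := exists_nonempty_closed_subset (κ := #M ^ #I)
    (Op := (I → I) × M) (β := I) hκ hOp hκI.le fun o s => e (realizers d s o.1) o.2
  obtain ⟨p, hp⟩ : ∃ p, p ∉ N := by
    by_contra! h
    rw [eq_univ_of_forall h, mk_univ] at hNκ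
    exact hα.not_ge hNκ
  refine ⟨N, hN0, p, hp, fun s hs => ?_⟩
  have hmem : ∀ m, e (realizers d s fun j => d (s j) p) m ∈ N := fun m => hN (_, m) s hs
  rcases he (realizers d s fun j => d (s j) p) with h | ⟨hinj, h⟩
  · obtain ⟨m, hm⟩ := h (show p ∈ _ from fun j => ⟨fun h => hp (h ▸ hs j), rfl⟩)
    exact absurd (hm ▸ hmem m) hp
  · exact mk_le_of_injective (f := fun m => (⟨_, hmem m, h m⟩ : ↥(N ∩ _)))
      fun m m' hmm => hinj (congrArg Subtype.val hmm)

/-- The common neighbors of `a` and `b` in color `i`. -/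
def commonNeighbors {α I : Type} (d : α → α → I) (i : I) (a b : α) : Set α :=
  {z | (z ≠ a ∧ d a z = i) ∧ z ≠ b ∧ d b z = i}

/-- In some color there is a nonempty set any two of whose points have at least `μ` common
neighbors in the set. -/
theorem exists_subset_le_mk_commonNeighbors {α I : Type} {μ : Cardinal.{0}} (hI : ℵ₀ ≤ #I)
    (hIμ : #I < μ.ord.cof) (hα : μ ^ #I < #α) (d : α → α → I) :
    ∃ i, ∃ A : Set α, A.Nonempty ∧
      ∀ a ∈ A, ∀ b ∈ A, μ ≤ #(A ∩ commonNeighbors d i a b : Set α) := by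
  have hIμ' : #I < μ := hIμ.trans_le (cof_ord_le μ)
  have hμ : ℵ₀ ≤ μ := hI.trans hIμ'.le
  obtain ⟨N, ⟨x, hx⟩, p, hp, hN⟩ := exists_saturated_subset hI hIμ'.le hα d
  obtain ⟨i, hi⟩ : ∃ i, ∀ s : I → α, (∀ j, s j ∈ N) →
      μ ≤ #({a ∈ N | d a p = i} ∩ realizers d s fun j => d (s j) p : Set α) := by
    by_contra! h
    choose s hs hlt using h
    obtain ⟨e⟩ : Nonempty (I ≃ I × I) := Cardinal.eq.1 (by simp [mul_eq_self hI])
    refine (hN (fun j => s (e j).1 (e j).2) fun j => hs _ _).not_gt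
      ((mk_le_mk_of_subset ?_).trans_lt (mk_iUnion_lt_of_lt_cof hμ hIμ hlt))
    rintro z ⟨hzN, hz⟩
    refine mem_iUnion.2 ⟨d z p, ⟨hzN, rfl⟩, fun j => ?_⟩
    simpa using hz (e.symm (d z p, j))
  have hI2 : ∃ j j' : I, j ≠ j' := by
    have : Infinite I := Cardinal.infinite_iff.2 hI
    exact exists_pair_ne I
  obtain ⟨j, j', hjj⟩ := hI2
  refine ⟨i, {a ∈ N | d a p = i}, ?_, ?_⟩
  · have h0 := (aleph0_pos.trans_le hμ).trans_le (hi (fun _ => x) fun _ => hx)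
    obtain ⟨⟨a, ha⟩⟩ := mk_ne_zero_iff.1 h0.ne'
    exact ⟨a, ha.1⟩
  · rintro a ⟨haN, rfl⟩ b ⟨hbN, hb⟩
    classical
    refine (hi (fun k => if k = j then a else b) fun k => ?_).trans
      (mk_le_mk_of_subset (inter_subset_inter_right _ fun z hz => ⟨?_, ?_⟩))
    · split_ifs <;> assumption
    · simpa using hz j
    · simpa [hjj.symm, hb] using hz j'

/-- A nonempty set any two of whose points have at least `μ` common neighbors in it contains a
set of size exactly `μ` with the same property. -/
theorem exists_subset_mk_eq_le_mk_commonNeighbors {α I : Type} {μ : Cardinal.{0}} (hμ : ℵ₀ ≤ μ)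
    {d : α → α → I} {i : I} {A : Set α} (hA : A.Nonempty)
    (h : ∀ a ∈ A, ∀ b ∈ A, μ ≤ #(A ∩ commonNeighbors d i a b : Set α)) :
    ∃ V : Set α, #V = μ ∧ ∀ a ∈ V, ∀ b ∈ V, μ ≤ #(V ∩ commonNeighbors d i a b : Set α) := by
  have : Nonempty A := hA.to_subtype
  induction μ using Cardinal.inductionOn with | _ M
  have he : ∀ a b : A, ∃ e : M → A, Function.Injective e ∧
      ∀ m, (e m : α) ∈ commonNeighbors d i a b := fun a b => by
    obtain ⟨e⟩ := Cardinal.le_def _ _ |>.1 (h a a.2 b b.2)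
    exact ⟨fun m => ⟨e m, (e m).2.1⟩, fun m m' hm => e.injective (Subtype.ext (by simpa using hm)),
      fun m => (e m).2.2⟩
  choose e hinj hmem using he
  obtain ⟨N, ⟨x, hx⟩, hNμ, hN⟩ := exists_nonempty_closed_subset (κ := #M) (Op := M) (β := Bool) hμ
    le_rfl (pow_le hμ (mk_lt_aleph0 (α := Bool))) fun m s => e (s true) (s false) m
  have hle : ∀ a ∈ N, ∀ b ∈ N,
      #M ≤ #(Subtype.val '' N ∩ commonNeighbors d i (a : α) b : Set α) := fun a ha b hb => by
    have hNe : ∀ m, e a b m ∈ N := fun m => hN m (fun t => cond t a b) (by simp [ha, hb])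
    exact mk_le_of_injective
      (f := fun m => (⟨e a b m, ⟨_, hNe m, rfl⟩, hmem a b m⟩ : ↥(Subtype.val '' N ∩ _)))
      fun m m' hm => hinj a b (Subtype.ext (Subtype.mk.inj hm))
  refine ⟨Subtype.val '' N, le_antisymm (mk_image_le.trans hNμ)
    ((hle x hx x hx).trans (mk_le_mk_of_subset inter_subset_left)), ?_⟩
  rintro _ ⟨a, ha, rfl⟩ _ ⟨b, hb, rfl⟩
  exact hle a ha b hb

/-- A graph any two vertices of which have at least as many common neighbors as there are
vertices is highly connected. -/
theorem highlyConnected_of_forall_mk_le {V : Set Ordinal.{0}} {E : Set (Ordinal.{0} × Ordinal.{0})}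
    (h : ∀ a ∈ V, ∀ b ∈ V, #V ≤ #{z ∈ V | GraphAdj E a z ∧ GraphAdj E z b}) :
    HighlyConnected V E := by
  rintro S - hS a ⟨ha, haS⟩ b ⟨hb, hbS⟩ -
  obtain ⟨z, ⟨hzV, haz, hzb⟩, hzS⟩ := not_subset.1 fun hsub =>
    ((h a ha b hb).trans (mk_le_mk_of_subset hsub)).not_gt hS
  refine ⟨2, ![a, z, b], rfl, rfl, ?_, ?_⟩
  · intro j
    fin_cases j
    exacts [⟨ha, haS⟩, ⟨hzV, hzS⟩, ⟨hb, hbS⟩]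
  · intro j
    fin_cases j
    exacts [haz, hzb]

/-- Lemma 7 (`gch`), second assertion: if moreover `μ ^ lam < ν`, then
`ν →_hc (μ)²_lam` holds as well. -/
theorem arrowHC_of_lt_cof_of_pow_lt (lam μ ν : Cardinal.{0}) (hlam : ℵ₀ ≤ lam)
    (h1 : lam < (μ.ord).cof) (h2 : (μ.ord).cof ≤ μ) (h3 : μ < ν)
    (h4 : μ ^ lam < ν) : ArrowHC ν μ lam := by
  intro c hc
  have hμ : ℵ₀ ≤ μ := hlam.trans (h1.le.trans h2)
  let ι : ν.ord.ToType → Ordinal.{0} := fun a => a.toOrd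
  have hι : Function.Injective ι := Subtype.val_injective.comp Ordinal.ToType.mk.symm.injective
  have hcolor : ∀ a b : ν.ord.ToType, a ≠ b →
      EdgeColor c a.toOrd b.toOrd < lam.ord := fun a b hab =>
    hc _ _ (min_lt_max.2 (hι.ne hab))
      (max_lt a.toOrd.2 b.toOrd.2)
  have hlam0 : (0 : Ordinal) < lam.ord := by
    simpa using aleph0_pos.trans_le hlam
  classical
  let d : ν.ord.ToType → ν.ord.ToType → lam.ord.ToType := fun a b =>
    if hab : a ≠ b then Ordinal.ToType.mk ⟨_, hcolor a b hab⟩ else Ordinal.ToType.mk ⟨0, hlam0⟩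
  obtain ⟨i, A, hA, hAi⟩ := exists_subset_le_mk_commonNeighbors (μ := μ) (by simpa) (by simpa)
    (by simpa) d
  obtain ⟨V, hVμ, hV⟩ := exists_subset_mk_eq_le_mk_commonNeighbors hμ hA hAi
  have hd : ∀ a z, z ≠ a → d a z = i → EdgeColor c (ι a) (ι z) = i.toOrd := by
    rintro a z hza rfl
    simp [d, hza.symm, ι]
  have hcard : ∀ B : Set ν.ord.ToType, #(ι '' B) = Cardinal.lift.{1} #B := fun B => by
    simpa using mk_image_eq_lift ι B hι
  let E : Set (Ordinal.{0} × Ordinal.{0}) :=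
    {p | p.1 ∈ ι '' V ∧ p.2 ∈ ι '' V ∧ p.1 < p.2 ∧ c p.1 p.2 = i.toOrd}
  have hadj : ∀ a ∈ V, ∀ z ∈ V, z ≠ a → d a z = i →
      GraphAdj E (ι a) (ι z) ∧ GraphAdj E (ι z) (ι a) := by
    intro a ha z hz hza haz
    have hcol := hd a z hza haz
    rcases lt_or_gt_of_ne (hι.ne hza) with hlt | hlt
    · rw [EdgeColor, min_eq_right hlt.le, max_eq_left hlt.le] at hcol
      have : (ι z, ι a) ∈ E := ⟨⟨z, hz, rfl⟩, ⟨a, ha, rfl⟩, hlt, hcol⟩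
      exact ⟨Or.inr this, Or.inl this⟩
    · rw [EdgeColor, min_eq_left hlt.le, max_eq_right hlt.le] at hcol
      have : (ι a, ι z) ∈ E := ⟨⟨a, ha, rfl⟩, ⟨z, hz, rfl⟩, hlt, hcol⟩
      exact ⟨Or.inl this, Or.inr this⟩
  refine ⟨i.toOrd, i.toOrd.2, ι '' V, E, ?_, by rw [hcard, hVμ], fun p hp => hp, ?_⟩
  · rintro _ ⟨a, -, rfl⟩
    exact a.toOrd.2
  · apply highlyConnected_of_forall_mk_le
    rintro _ ⟨a, ha, rfl⟩ _ ⟨b, hb, rfl⟩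
    rw [hcard, hVμ]
    refine (lift_le.2 (hV a ha b hb)).trans ((hcard _).symm.le.trans (mk_le_mk_of_subset ?_))
    rintro _ ⟨z, ⟨hzV, ⟨hza, hdaz⟩, hzb, hdbz⟩, rfl⟩
    exact ⟨⟨z, hzV, rfl⟩, (hadj a ha z hzV hza hdaz).1, (hadj b hb z hzV hzb hdbz).2⟩

end
end

section
/- Let μ be an infinite cardinal. Then μ⁺ ↛_wc (ω₁)²_μ: there exists a coloring c of the unordered pairs of ordinals below the successor cardinal μ⁺ by μ colors such that no set X ⊆ μ⁺ of cardinality ℵ₁ is well-connected in any color. -/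
open Cardinal Ordinal Set

noncomputable section

theorem exists_injOn_Iio_lt_ord {μ : Cardinal.{0}} {b : Ordinal.{0}}
    (hb : b < (Order.succ μ).ord) :
    ∃ f : Ordinal.{0} → Ordinal.{0}, (∀ a < b, f a < μ.ord) ∧ Set.InjOn f (Set.Iio b) := by
  have hcard : #(Set.Iio b) ≤ #(Set.Iio μ.ord) := by
    rw [Cardinal.mk_Iio_ordinal, Cardinal.mk_Iio_ordinal, Cardinal.lift_le, card_ord]
    exact Order.lt_succ_iff.1 (lt_ord.1 hb)
  obtain ⟨e⟩ := hcard
  refine ⟨fun a => if h : a < b then e ⟨a, h⟩ else 0, fun a ha => ?_, fun x hx y hy hxy => ?_⟩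
  · simp only [dif_pos ha]
    exact (e ⟨a, ha⟩).2
  · simp only [Set.mem_Iio] at hx hy
    simp only [dif_pos hx, dif_pos hy] at hxy
    exact congrArg Subtype.val (e.injective (Subtype.ext hxy))

/-- `Parent c i b a` says that `a` is a neighbor of `b` below `b` in the color `i`. -/
def Parent (c : Ordinal.{0} → Ordinal.{0} → Ordinal.{0}) (i b a : Ordinal.{0}) : Prop :=
  a < b ∧ c a b = i

theorem finite_setOf_reflTransGen_parent {ν : Ordinal.{0}}
    {c : Ordinal.{0} → Ordinal.{0} → Ordinal.{0}} {i : Ordinal.{0}}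
    (huniq : ∀ b < ν, ∀ a a', Parent c i b a → Parent c i b a' → a = a')
    {b : Ordinal.{0}} (hb : b < ν) : {a | Relation.ReflTransGen (Parent c i) b a}.Finite := by
  induction b using WellFoundedLT.induction with
  | ind b ih =>
    by_cases h : ∃ w, Parent c i b w
    · obtain ⟨w, hw⟩ := h
      refine ((ih w hw.1 (hw.1.trans hb)).insert b).subset fun a ha => ?_
      rcases Relation.ReflTransGen.cases_head ha with rfl | ⟨w', hw', h'⟩
      · exact Set.mem_insert _ _
      · exact Set.mem_insert_of_mem _ (huniq b hb _ _ hw hw' ▸ h')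
    · refine (Set.finite_singleton b).subset fun a ha => ?_
      rcases Relation.ReflTransGen.cases_head ha with rfl | ⟨w, hw, -⟩
      · rfl
      · exact absurd ⟨w, hw⟩ h

theorem countable_of_finite_inter_Iio {α : Type*} [LinearOrder α] {X : Set α}
    (hX : ∀ b ∈ X, (X ∩ Set.Iio b).Finite) : X.Countable := by
  have hmono : StrictMonoOn (fun b => (X ∩ Set.Iio b).ncard) X := by
    intro a ha b hb hab
    refine Set.ncard_lt_ncard ⟨fun x hx => ⟨hx.1, lt_trans hx.2 hab⟩, fun h => ?_⟩ (hX b hb)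
    exact lt_irrefl a (h ⟨ha, hab⟩).2
  exact Set.MapsTo.countable_of_injOn (Set.mapsTo_univ _ _) hmono.injOn Set.countable_univ

/-- If smaller neighbors in the color `i` are unique, then a path of color `i` which stays above
its starting point `v 0` only visits descendants of `v 0`. -/
theorem reflTransGen_parent_of_path {ν : Ordinal.{0}}
    {c : Ordinal.{0} → Ordinal.{0} → Ordinal.{0}} {i : Ordinal.{0}}
    (huniq : ∀ b < ν, ∀ a a', Parent c i b a → Parent c i b a' → a = a')
    {n : ℕ} {v : Fin (n + 1) → Ordinal.{0}} (hv : ∀ j, v j < ν ∧ v 0 ≤ v j)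
    (hedge : ∀ j : Fin n, v j.castSucc ≠ v j.succ ∧ EdgeColor c (v j.castSucc) (v j.succ) = i)
    (j : Fin (n + 1)) : Relation.ReflTransGen (Parent c i) (v j) (v 0) := by
  induction j using Fin.induction with
  | zero => exact .refl
  | succ j ih =>
    obtain ⟨hne, hcol⟩ := hedge j
    rcases lt_or_gt_of_ne hne with h | h
    · rw [EdgeColor, min_eq_left h.le, max_eq_right h.le] at hcol
      exact .head ⟨h, hcol⟩ ih
    · rw [EdgeColor, min_eq_right h.le, max_eq_left h.le] at hcol
      rcases Relation.ReflTransGen.cases_head ih with heq | ⟨w, hw, hw'⟩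
      · exact absurd (heq ▸ h) (hv j.succ).2.not_gt
      · rwa [huniq _ (hv _).1 _ _ ⟨h, hcol⟩ hw]

/-- Lemma 8 (`muplus`), second negative relation: for every infinite cardinal `μ`,
`μ⁺ ↛_wc (ω₁)²_μ`: some coloring of the pairs below `μ⁺` by `μ` colors admits no set
of cardinality `ℵ₁` well-connected in any color. -/
theorem wc_negative_succ_aleph_one (μ : Cardinal.{0}) (hμ : ℵ₀ ≤ μ) :
    ∃ c : Ordinal.{0} → Ordinal.{0} → Ordinal.{0}, IsColoring (Order.succ μ) μ c ∧
      ∀ i, i < μ.ord → ∀ X : Set Ordinal.{0}, X ⊆ Set.Iio (Order.succ μ).ord →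
        #X = Cardinal.lift.{1} (Cardinal.aleph.{0} 1) →
        ¬ WellConnectedIn (Order.succ μ) c i X := by
  choose f hlt hinj using fun (b : Ordinal.{0}) (hb : b < (Order.succ μ).ord) =>
    exists_injOn_Iio_lt_ord hb
  let c : Ordinal.{0} → Ordinal.{0} → Ordinal.{0} :=
    fun a b => if hb : b < (Order.succ μ).ord then f b hb a else 0
  refine ⟨c, fun a b hab hb => by simpa [c, hb] using hlt b hb a hab, ?_⟩
  intro i _ X hX hcard hwc
  have huniq : ∀ b < (Order.succ μ).ord, ∀ a a', Parent c i b a → Parent c i b a' → a = a' := by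
    rintro b hb a a' ⟨hab, h⟩ ⟨hab', h'⟩
    refine hinj b hb hab hab' ?_
    simpa [c, hb] using h.trans h'.symm
  have hcount : X.Countable := countable_of_finite_inter_Iio fun b hb => by
    refine (finite_setOf_reflTransGen_parent huniq (hX hb)).subset ?_
    rintro a ⟨ha, hab⟩
    obtain ⟨n, v, rfl, rfl, hv, hedge⟩ := hwc a ha b hb hab
    exact reflTransGen_parent_of_path huniq hv hedge _
  have hle : lift.{1} (ℵ_ 1) ≤ ℵ₀ := hcard ▸ hcount.le_aleph0
  exact (Cardinal.lift_le_aleph0.1 hle).not_gt aleph0_lt_aleph_one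

end
end

section
/- Let ν be a cardinal, λ a cardinal, and let c be a coloring of the unordered pairs of ordinals below ν by λ colors satisfying c(α, γ) ≠ c(β, γ) whenever α < β < γ < ν. Then every monochromatic highly connected subgraph has at most 2 vertices: if V ⊆ ν, E is a set of pairs from V all assigned the same color by c, and the graph (V, E) is highly connected, then |V| ≤ 2. -/
open Cardinal Ordinal Set

noncomputable section

/-- If every vertex of a connected graph has at most one lower neighbor, then every vertex that is
not the least one has a lower neighbor. -/
theorem ConnectedOn.exists_lower_neighbor {E : Set (Ordinal.{0} × Ordinal.{0})}
    {W : Set Ordinal.{0}} (hW : ConnectedOn E W) (hlt : ∀ p ∈ E, p.1 < p.2)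
    (huniq : ∀ a b x, (a, x) ∈ E → (b, x) ∈ E → a = b) {m y : Ordinal}
    (hm : m ∈ W) (hy : y ∈ W) (hmy : m < y) : ∃ p ∈ W, (p, y) ∈ E := by
  by_contra! h
  obtain ⟨n, v, h0, hlast, hvW, hadj⟩ := hW y hy m hm hmy.ne'
  have key : ∀ j, Relation.ReflTransGen (fun a b ↦ (a, b) ∈ E) y (v j) := by
    intro j
    induction j using Fin.induction with
    | zero => rw [h0]
    | succ j ih =>
      rcases hadj j with hj | hj
      · exact ih.tail hj
      · rcases ih.cases_tail with heq | ⟨z, hyz, hz⟩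
        · rw [heq] at hj
          exact absurd hj (h _ (hvW _))
        · rwa [huniq _ _ _ hj hz]
  have hle : ∀ z, Relation.ReflTransGen (fun a b ↦ (a, b) ∈ E) y z → y ≤ z := by
    intro z hz
    induction hz with
    | refl => exact le_rfl
    | tail _ hbc ih => exact ih.trans (hlt _ hbc).le
  exact (hle _ (hlast ▸ key (Fin.last n))).not_gt hmy

/-- A set with more than two elements in a linear order contains a strictly increasing triple. -/
theorem exists_lt_lt_of_two_lt_mk {α : Type*} [LinearOrder α] {V : Set α} (h : 2 < #V) :
    ∃ a ∈ V, ∃ b ∈ V, ∃ y ∈ V, a < b ∧ b < y := by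
  have h3 : ((3 : ℕ) : Cardinal) ≤ #V := by
    rw [← Nat.cast_ofNat] at h
    exact_mod_cast Cardinal.succ_natCast 2 ▸ Order.succ_le_of_lt h
  obtain ⟨s, hs⟩ := Cardinal.exists_finset_eq_card h3
  have hs' : s.card = 3 := by exact_mod_cast hs.symm
  let f := s.orderEmbOfFin hs'
  exact ⟨f 0, (f 0).2, f 1, (f 1).2, f 2, (f 2).2,
    f.strictMono (by decide), f.strictMono (by decide)⟩

/-- For a coloring with `c α γ ≠ c β γ` whenever `α < β < γ < ν`, every monochromatic
highly connected subgraph has at most `2` vertices. -/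
theorem hc_monochromatic_le_two (ν lam : Cardinal.{0})
    (c : Ordinal.{0} → Ordinal.{0} → Ordinal.{0}) (hc : IsColoring ν lam c)
    (hinj : ∀ α β γ : Ordinal, α < β → β < γ → γ < ν.ord → c α γ ≠ c β γ)
    (V : Set Ordinal.{0}) (E : Set (Ordinal.{0} × Ordinal.{0})) (i : Ordinal)
    (hV : V ⊆ Set.Iio ν.ord)
    (hE : ∀ p ∈ E, p.1 ∈ V ∧ p.2 ∈ V ∧ p.1 < p.2 ∧ c p.1 p.2 = i)
    (hhc : HighlyConnected V E) : #V ≤ 2 := by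
  by_contra! hcard
  obtain ⟨a, ha, b, hb, y, hy, hab, hby⟩ := exists_lt_lt_of_two_lt_mk hcard
  have hlt : ∀ p ∈ E, p.1 < p.2 := fun p hp ↦ (hE p hp).2.2.1
  have huniq : ∀ p q x, (p, x) ∈ E → (q, x) ∈ E → p = q := by
    intro p q x hp hq
    obtain ⟨-, hx, hpx, hcp⟩ := hE _ hp
    obtain ⟨-, -, hqx, hcq⟩ := hE _ hq
    rcases lt_trichotomy p q with hpq | hpq | hpq
    · exact absurd (hcp.trans hcq.symm) (hinj p q x hpq hqx (hV hx))
    · exact hpq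
    · exact absurd (hcq.trans hcp.symm) (hinj q p x hpq hpx (hV hx))
  have hconn : ∀ x ∈ V, ConnectedOn E (V \ {x}) := fun x hx ↦
    hhc {x} (Set.singleton_subset_iff.2 hx) <| by
      rw [Cardinal.mk_singleton]
      exact Cardinal.one_lt_two.trans hcard
  obtain ⟨p, ⟨hpV, hpa⟩, hp⟩ := (hconn a ha).exists_lower_neighbor hlt huniq
    (m := b) ⟨hb, hab.ne'⟩ ⟨hy, (hab.trans hby).ne'⟩ hby
  obtain ⟨q, ⟨-, hqp⟩, hq⟩ := (hconn p hpV).exists_lower_neighbor hlt huniq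
    (m := a) ⟨ha, fun h ↦ hpa h.symm⟩ ⟨hy, (hlt _ hp).ne'⟩ (hab.trans hby)
  exact hqp (huniq _ _ _ hq hp)

end
end

section
/- Let ν be a cardinal, λ a cardinal, and let c be a coloring of the unordered pairs of ordinals below ν by λ colors satisfying c(α, γ) ≠ c(β, γ) whenever α < β < γ < ν. Then every set X ⊆ ν which is well-connected in some color i < λ has order type at most ω. -/
open Cardinal Ordinal Set

noncomputable section

/-- The order type of a set of ordinals. -/
def setOtp (X : Set Ordinal.{0}) : Ordinal.{1} :=
  @Ordinal.type X (Subrel (· < ·) X)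
    (@RelEmbedding.isWellOrder _ _ _ _ (Subrel.relEmbedding _ _) isWellOrder_lt)


/-- If `R`-predecessors are unique and `R` is contained in a well-founded relation, then every
element has only finitely many `R`-ancestors. -/
theorem finite_setOf_reflTransGen {A : Type*} [Preorder A] [WellFoundedLT A]
    {R : A → A → Prop} (hlt : ∀ a b, R a b → a < b)
    (huniq : ∀ a a' b, R a b → R a' b → a = a') (b : A) :
    {a | Relation.ReflTransGen R a b}.Finite := by
  induction b using WellFoundedLT.induction with
  | ind b ih =>
    by_cases h : ∃ p, R p b
    · obtain ⟨p, hp⟩ := h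
      refine ((ih p (hlt p b hp)).insert b).subset fun a ha => ?_
      rcases Relation.ReflTransGen.cases_tail ha with hab | ⟨q, hq, hqb⟩
      · exact Or.inl hab.symm
      · obtain rfl := huniq q p b hqb hp
        exact Or.inr hq
    · refine (Set.finite_singleton b).subset fun a ha => ?_
      rcases Relation.ReflTransGen.cases_tail ha with hab | ⟨q, -, hqb⟩
      · exact hab.symm
      · exact absurd ⟨q, hqb⟩ h

/-- If `R`-predecessors are unique and smaller, then every walk from `a` in the symmetrization of
`R` that never goes below `a` stays among the `R`-descendants of `a`. -/
theorem reflTransGen_of_walk {A : Type*} [Preorder A] {R : A → A → Prop}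
    (hlt : ∀ a b, R a b → a < b) (huniq : ∀ a a' b, R a b → R a' b → a = a')
    {n : ℕ} {v : Fin (n + 1) → A} {a : A} (h0 : v 0 = a) (hge : ∀ j, a ≤ v j)
    (hstep : ∀ j : Fin n, R (v j.castSucc) (v j.succ) ∨ R (v j.succ) (v j.castSucc))
    (j : Fin (n + 1)) : Relation.ReflTransGen R a (v j) := by
  induction j using Fin.induction with
  | zero => rw [h0]
  | succ j ih =>
    rcases hstep j with h | h
    · exact ih.tail h
    · rcases Relation.ReflTransGen.cases_tail ih with heq | ⟨q, hq, hqj⟩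
      · rw [heq] at h
        exact absurd (hlt _ _ h) (hge j.succ).not_gt
      · rwa [huniq _ _ _ h hqj]

/-- A set of ordinals all of whose proper initial segments are finite has order type at
most `ω`. -/
theorem setOtp_le_omega0 {X : Set Ordinal.{0}}
    (h : ∀ b ∈ X, {a | a ∈ X ∧ a < b}.Finite) : setOtp X ≤ Ordinal.omega0 := by
  let _ : IsWellOrder X (Subrel (· < ·) (· ∈ X)) :=
    @RelEmbedding.isWellOrder _ _ _ _ (Subrel.relEmbedding _ _) isWellOrder_lt
  refine le_of_forall_lt fun o ho => ?_
  obtain ⟨⟨b, hb⟩, rfl⟩ := Ordinal.typein_surj (Subrel (· < ·) (· ∈ X)) ho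
  rw [← Ordinal.card_lt_aleph0, Ordinal.card_typein, Cardinal.lt_aleph0_iff_finite]
  have := (h b hb).to_subtype
  exact Finite.of_injective
    (fun a => (⟨a.1.1, a.1.2, a.2⟩ : {a | a ∈ X ∧ a < b}))
    fun a a' haa => Subtype.ext (Subtype.ext (congrArg (fun z => z.1) haa))

/-- For a coloring with `c α γ ≠ c β γ` whenever `α < β < γ < ν`, every set `X ⊆ ν`
well-connected in some color has order type at most `ω`. -/
theorem wc_otp_le_omega (ν lam : Cardinal.{0})
    (c : Ordinal.{0} → Ordinal.{0} → Ordinal.{0}) (hc : IsColoring ν lam c)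
    (hinj : ∀ α β γ : Ordinal, α < β → β < γ → γ < ν.ord → c α γ ≠ c β γ)
    (i : Ordinal) (hi : i < lam.ord) (X : Set Ordinal.{0}) (hX : X ⊆ Set.Iio ν.ord)
    (hwc : WellConnectedIn ν c i X) : setOtp X ≤ Ordinal.omega0 := by
  let R : Ordinal → Ordinal → Prop := fun a b => a < b ∧ b < ν.ord ∧ c a b = i
  have hlt : ∀ a b, R a b → a < b := fun a b h => h.1
  have huniq : ∀ a a' b, R a b → R a' b → a = a' := by
    rintro a a' b ⟨hab, hb, hi₁⟩ ⟨hab', -, hi₂⟩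
    rcases lt_trichotomy a a' with h | h | h
    · exact absurd (hi₁.trans hi₂.symm) (hinj a a' b h hab' hb)
    · exact h
    · exact absurd (hi₂.trans hi₁.symm) (hinj a' a b h hab hb)
  refine setOtp_le_omega0 fun b hb =>
    (finite_setOf_reflTransGen hlt huniq b).subset fun a ⟨ha, hab⟩ => ?_
  obtain ⟨n, v, h0, hlast, hv, hstep⟩ := hwc a ha b hb hab
  rw [Set.mem_ofPred_eq, ← hlast]
  refine reflTransGen_of_walk hlt huniq h0 (fun j => (hv j).2) (fun j => ?_) (Fin.last n)
  obtain ⟨hne, hcol⟩ := hstep j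
  rcases hne.lt_or_gt with h | h
  · rw [EdgeColor, min_eq_left h.le, max_eq_right h.le] at hcol
    exact Or.inl ⟨h, (hv _).1, hcol⟩
  · rw [EdgeColor, min_eq_right h.le, max_eq_left h.le] at hcol
    exact Or.inr ⟨h, (hv _).1, hcol⟩

end
end

section
/- ω₁ ↛_wc (3)²_ω: there exists a coloring c of the unordered pairs of countable ordinals by countably many colors such that no three-element set X ⊆ ω₁ is well-connected in any color. -/
open Cardinal Ordinal Set

noncomputable section

theorem countable_Iio_of_lt_ord_aleph_one {b : Ordinal.{0}} (hb : b < (Cardinal.aleph 1).ord) :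
    Countable (Set.Iio b) := by
  rw [← Cardinal.mk_le_aleph0_iff, Cardinal.mk_Iio_ordinal, Cardinal.lift_le_aleph0]
  rw [Cardinal.lt_ord, ← Cardinal.succ_aleph0, Order.lt_succ_iff] at hb
  exact hb

theorem exists_injOn_Iio_ord_aleph_one :
    ∃ r : Ordinal.{0} → Set ℕ, Set.InjOn r (Set.Iio (Cardinal.aleph 1).ord) := by
  have h : Cardinal.lift.{0} #(Set.Iio (Cardinal.aleph.{0} 1).ord) ≤
      Cardinal.lift.{1} #(Set ℕ) := by
    rw [Cardinal.mk_Iio_ordinal, Cardinal.card_ord, Cardinal.mk_set, Cardinal.mk_nat]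
    simpa using Cardinal.aleph_one_le_continuum
  obtain ⟨f⟩ := Cardinal.lift_mk_le'.1 h
  classical
  refine ⟨fun a => if h : a ∈ Set.Iio (Cardinal.aleph 1).ord then f ⟨a, h⟩ else ∅, ?_⟩
  intro a ha b hb hab
  simp only [dif_pos ha, dif_pos hb] at hab
  exact congrArg Subtype.val (f.injective hab)

/-- There is a coloring of the pairs of countable ordinals by natural numbers which is injective
in the smaller coordinate and takes distinct values on consecutive pairs. -/
theorem exists_injective_shift_coloring :
    ∃ f : Ordinal.{0} → Ordinal.{0} → ℕ,
      (∀ a a' b, a < b → a' < b → b < (Cardinal.aleph 1).ord → f a b = f a' b → a = a') ∧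
      ∀ a b d, a < b → b < d → d < (Cardinal.aleph 1).ord → f a b ≠ f b d := by
  classical
  obtain ⟨r, hr⟩ := exists_injOn_Iio_ord_aleph_one
  have he : ∀ b : Ordinal.{0}, ∃ e : Ordinal.{0} → ℕ,
      b < (Cardinal.aleph 1).ord → Set.InjOn e (Set.Iio b) := by
    intro b
    by_cases hb : b < (Cardinal.aleph 1).ord
    · have := countable_Iio_of_lt_ord_aleph_one hb
      obtain ⟨e, he⟩ := Set.countable_iff_exists_injOn.1 (Set.to_countable (Set.Iio b))
      exact ⟨e, fun _ => he⟩
    · exact ⟨fun _ => 0, fun h => absurd h hb⟩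
  choose e he using he
  have hd : ∀ a b : Ordinal.{0}, ∃ n : ℕ, a < b → b < (Cardinal.aleph 1).ord →
      ¬ (n ∈ r a ↔ n ∈ r b) := by
    intro a b
    by_contra! h
    have hab := (h 0).1
    have hb := (h 0).2.1
    exact hab.ne (hr (hab.trans hb) hb (Set.ext fun n => (h n).2.2))
  choose δ hδ using hd
  refine ⟨fun a b => Nat.pair (e b a) (Nat.pair (δ a b) (if δ a b ∈ r a then 1 else 0)), ?_, ?_⟩
  · intro a a' b ha ha' hb h
    exact he b hb ha ha' (Nat.pair_eq_pair.1 h).1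
  · intro a b d hab hbd hd h
    obtain ⟨h₁, h₂⟩ := Nat.pair_eq_pair.1 (Nat.pair_eq_pair.1 h).2
    have h₃ := hδ a b hab (hbd.trans hd)
    rw [← h₁] at h₂
    split_ifs at h₂ <;> tauto

/-- `ω₁ ↛_wc (3)²_ω`: there is a coloring of the pairs of countable ordinals by
countably many colors such that no three-element set is well-connected in any color. -/
theorem wc_negative_omega_one_three :
    ∃ c : Ordinal.{0} → Ordinal.{0} → Ordinal.{0}, IsColoring (Cardinal.aleph 1) ℵ₀ c ∧
      ∀ i, i < (ℵ₀ : Cardinal.{0}).ord → ∀ X : Set Ordinal.{0},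
        X ⊆ Set.Iio (Cardinal.aleph 1).ord → #X = 3 →
        ¬ WellConnectedIn (Cardinal.aleph 1) c i X := by
  obtain ⟨f, hinj, hshift⟩ := exists_injective_shift_coloring
  refine ⟨fun a b => (f a b : Ordinal), ?_, ?_⟩
  · intro a b _ _
    simp only [Cardinal.ord_aleph0]
    exact Ordinal.natCast_lt_omega0 _
  intro i _ X _ hX hwc
  have chain : ∀ a ∈ X, ∀ b ∈ X, ∀ d ∈ X, a < b → b < d → False := by
    intro a ha b hb d hd hab hbd
    obtain ⟨n, v, hv0, hvn, hv, hvc⟩ := hwc a ha b hb hab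
    obtain ⟨m, w, hw0, hwm, hw, hwc⟩ := hwc b hb d hd hbd
    have star : ∀ j, v j = a ∨ (a < v j ∧ (f a (v j) : Ordinal) = i) := by
      intro j
      induction j using Fin.induction with
      | zero => exact Or.inl hv0
      | succ j ih =>
        obtain ⟨hne, hc⟩ := hvc j
        have hx := (hv j.castSucc).1
        obtain ⟨hy, hay⟩ := hv j.succ
        rcases ih with ih | ⟨hax, hcx⟩
        · have hlt : a < v j.succ := lt_of_le_of_ne hay (ih ▸ hne)
          rw [EdgeColor, ih, min_eq_left hay, max_eq_right hay] at hc
          exact Or.inr ⟨hlt, hc⟩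
        · rcases lt_or_gt_of_ne hne with hlt | hlt
          · rw [EdgeColor, min_eq_left hlt.le, max_eq_right hlt.le] at hc
            exact absurd (Nat.cast_injective (hcx.trans hc.symm)) (hshift _ _ _ hax hlt hy)
          · rw [EdgeColor, min_eq_right hlt.le, max_eq_left hlt.le] at hc
            exact Or.inl (hinj _ _ _ hlt hax hx (Nat.cast_injective (hc.trans hcx.symm)))
    have hci : (f a b : Ordinal) = i := by
      rcases star (Fin.last n) with h | h
      · exact absurd (hvn.symm.trans h) hab.ne'
      · exact hvn ▸ h.2
    cases m with
    | zero => exact hbd.ne (hw0.symm.trans hwm)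
    | succ m =>
      obtain ⟨hne, hc⟩ := hwc 0
      obtain ⟨hy, hby⟩ := hw (Fin.succ 0)
      rw [Fin.castSucc_zero, hw0] at hne hc
      rw [EdgeColor, min_eq_left hby, max_eq_right hby] at hc
      exact hshift _ _ _ hab (lt_of_le_of_ne hby hne) hy
        (Nat.cast_injective (hci.trans hc.symm))
  have hcard : X.ncard = 3 := by
    rw [← Nat.card_coe_set_eq, Nat.card, hX]
    simp
  obtain ⟨x, y, z, hxy, hxz, hyz, rfl⟩ := Set.ncard_eq_three.1 hcard
  have hx : x ∈ ({x, y, z} : Set Ordinal.{0}) := by simp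
  have hy : y ∈ ({x, y, z} : Set Ordinal.{0}) := by simp
  have hz : z ∈ ({x, y, z} : Set Ordinal.{0}) := by simp
  rcases lt_or_gt_of_ne hxy with h₁ | h₁ <;> rcases lt_or_gt_of_ne hxz with h₂ | h₂ <;>
    rcases lt_or_gt_of_ne hyz with h₃ | h₃
  · exact chain x hx y hy z hz h₁ h₃
  · exact chain x hx z hz y hy h₂ h₃
  · exact chain x hx y hy z hz h₁ h₃
  · exact chain z hz x hx y hy h₂ h₁
  · exact chain y hy x hx z hz h₁ h₂
  · exact chain y hy x hx z hz h₁ h₂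
  · exact chain y hy z hz x hx h₃ h₂
  · exact chain z hz y hy x hx h₃ h₁

end
end

section
/- Let ν, λ be cardinals, let c be a coloring of the unordered pairs of ordinals below ν by λ colors, and fix a color i < λ. Define α ◁_i β if and only if α < β and the pair {α, β} is well-connected in the color i. Then ◁_i is a tree-ordering of ν: for every β < ν, the set of ◁_i-predecessors of β is linearly ordered by ◁_i (indeed, any two distinct ◁_i-predecessors of β are ◁_i-comparable). -/
open Cardinal Ordinal Set

noncomputable section

/-- `α ◁_i β`: `α < β` and the pair `{α, β}` is well-connected in the color `i`. -/
def WCRel (ν : Cardinal.{0}) (c : Ordinal.{0} → Ordinal.{0} → Ordinal.{0}) (i : Ordinal)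
    (α β : Ordinal) : Prop :=
  α < β ∧ WellConnectedIn ν c i {α, β}


/-- `a` and `b` are joined by an edge of color `i`, and both lie in the interval `[α, ν)`. -/
def StepAbove (ν : Cardinal.{0}) (c : Ordinal.{0} → Ordinal.{0} → Ordinal.{0})
    (i α a b : Ordinal.{0}) : Prop :=
  (a ≠ b ∧ EdgeColor c a b = i) ∧ (a < ν.ord ∧ α ≤ a) ∧ (b < ν.ord ∧ α ≤ b)

section StepAbove

variable {ν : Cardinal.{0}} {c : Ordinal.{0} → Ordinal.{0} → Ordinal.{0}} {i α α' β γ : Ordinal.{0}}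

theorem EdgeColor.symm (a b : Ordinal.{0}) : EdgeColor c a b = EdgeColor c b a := by
  simp only [EdgeColor, min_comm, max_comm]

theorem StepAbove.symmetric : Std.Symm (StepAbove ν c i α) :=
  ⟨fun a b h => ⟨⟨h.1.1.symm, (EdgeColor.symm b a).trans h.1.2⟩, h.2.2, h.2.1⟩⟩

theorem StepAbove.mono (h : α ≤ α') {a b : Ordinal.{0}} (hs : StepAbove ν c i α' a b) :
    StepAbove ν c i α a b :=
  ⟨hs.1, ⟨hs.2.1.1, h.trans hs.2.1.2⟩, hs.2.2.1, h.trans hs.2.2.2⟩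

theorem exists_path_iff_reflTransGen (hβ : β < ν.ord) (hαβ : α ≤ β) :
    (∃ n : ℕ, ∃ v : Fin (n + 1) → Ordinal,
      v 0 = γ ∧ v (Fin.last n) = β ∧ (∀ j, v j < ν.ord ∧ α ≤ v j) ∧
      ∀ j : Fin n, v j.castSucc ≠ v j.succ ∧ EdgeColor c (v j.castSucc) (v j.succ) = i) ↔
    Relation.ReflTransGen (StepAbove ν c i α) γ β := by
  constructor
  · rintro ⟨n, v, rfl, rfl, hv, he⟩
    suffices ∀ j, Relation.ReflTransGen (StepAbove ν c i α) (v 0) (v j) from this _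
    intro j
    induction j using Fin.induction with
    | zero => exact .refl
    | succ j ih => exact ih.tail ⟨he j, hv _, hv _⟩
  · intro h
    induction h using Relation.ReflTransGen.head_induction_on with
    | refl => exact ⟨0, fun _ => β, rfl, rfl, fun _ => ⟨hβ, hαβ⟩, fun j => j.elim0⟩
    | @head a b hs _ ih =>
      obtain ⟨n, v, rfl, hl, hv, he⟩ := ih
      refine ⟨n + 1, Fin.cons a v, rfl, ?_, ?_, ?_⟩
      · rw [← Fin.succ_last, Fin.cons_succ, hl]
      · exact Fin.cases hs.2.1 hv
      · exact Fin.cases hs.1 he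

theorem wcRel_iff (hβ : β < ν.ord) :
    WCRel ν c i α β ↔ α < β ∧ Relation.ReflTransGen (StepAbove ν c i α) α β := by
  refine and_congr_right fun hlt => ?_
  rw [← exists_path_iff_reflTransGen hβ hlt.le]
  refine ⟨fun h => h α (by simp) β (by simp) hlt, fun h x hx y hy hxy => ?_⟩
  obtain rfl | rfl := hx <;> obtain rfl | rfl := hy
  · exact (lt_irrefl _ hxy).elim
  · exact h
  · exact (lt_asymm hxy hlt).elim
  · exact (lt_irrefl _ hxy).elim

theorem WCRel.of_lt (hβ : β < ν.ord) (hα : WCRel ν c i α β) (hγ : WCRel ν c i γ β)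
    (hlt : α < γ) : WCRel ν c i α γ := by
  have hγβ := (wcRel_iff hβ).1 hγ
  have hsymm : Std.Symm (StepAbove ν c i α) := StepAbove.symmetric
  refine (wcRel_iff (hγβ.1.trans hβ)).2 ⟨hlt, ((wcRel_iff hβ).1 hα).2.trans ?_⟩
  exact symm (Relation.ReflTransGen.mono (fun _ _ => StepAbove.mono hlt.le) _ _ hγβ.2)

end StepAbove

/-- Lemma 11 (`trees`): the relation `◁_i` is a tree-ordering of `ν`: the set of
`◁_i`-predecessors of any `β < ν` is linearly ordered by `◁_i` (any two distinct
predecessors are comparable). -/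
theorem wcRel_tree_ordering (ν lam : Cardinal.{0})
    (c : Ordinal.{0} → Ordinal.{0} → Ordinal.{0}) (hc : IsColoring ν lam c)
    (i : Ordinal) (hi : i < lam.ord) :
    ∀ β, β < ν.ord → ∀ α₁ α₂ : Ordinal, WCRel ν c i α₁ β → WCRel ν c i α₂ β →
      α₁ ≠ α₂ → WCRel ν c i α₁ α₂ ∨ WCRel ν c i α₂ α₁ := by
  intro β hβ α₁ α₂ h₁ h₂ hne
  exact hne.lt_or_gt.imp (h₁.of_lt hβ h₂) (h₂.of_lt hβ h₁)

end
end
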